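/- arXiv:2512.11007 — 2 statements merged into one kernel-verified Lean document; each statement's English description precedes it below -/
import Mathlib

section
/- Let P be an isomorphism-invariant property of finite monoids that is closed under taking submonoids, images under surjective monoid homomorphisms, and binary direct products (i.e., P is a monoid pseudovariety). Then every synchronizing DFA whose transition monoid satisfies P admits a uniform winning strategy if and only if every finite monoid satisfying P lies in the pseudovariety DS. -/
open MulOpposite

variable {Q σ : Type*}

/-- The action of a word on a state: `q·w`. -/
def run (step : Q → σ → Q) (q : Q) (w : List σ) : Q := w.foldl step q

/-- A reset word. -/
def IsReset (step : Q → σ → Q) (w : List σ) : Prop :=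
  ∀ p q : Q, run step p w = run step q w

/-- The interleaving `a₁b₁a₂b₂⋯` of two words. -/
def interleave {α : Type*} (as bs : List α) : List α :=
  (as.zip bs).flatMap fun p => [p.1, p.2]

/-- The self-map of `Q` induced by the word `w`. -/
def tau (step : Q → σ → Q) (w : List σ) : Function.End Q := fun q => run step q w

/-- The transition monoid: self-maps of `Q` induced by words, with composition
written left to right (realized via the opposite of `Function.End Q`). -/
def transMonoid (step : Q → σ → Q) : Submonoid (Function.End Q)ᵐᵒᵖ where
  carrier := {f | ∃ w : List σ, f = op (tau step w)}
  one_mem' := ⟨[], rfl⟩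
  mul_mem' := by
    rintro f g ⟨u, rfl⟩ ⟨v, rfl⟩
    refine ⟨u ++ v, ?_⟩
    rw [← op_mul]
    congr 1
    funext q
    show tau step v (tau step u q) = tau step (u ++ v) q
    simp [tau, run, List.foldl_append]

/-- Green's relation ℛ. -/
def GreenR {M : Type*} [Monoid M] (x y : M) : Prop :=
  x = y ∨ ∃ s t : M, x = y * s ∧ y = x * t

/-- Green's relation ℒ. -/
def GreenL {M : Type*} [Monoid M] (x y : M) : Prop :=
  x = y ∨ ∃ s t : M, x = s * y ∧ y = t * x

/-- Green's relation 𝒟. -/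
def GreenD {M : Type*} [Monoid M] (x y : M) : Prop :=
  ∃ c : M, GreenR x c ∧ GreenL c y

/-- A regular element of a monoid. -/
def IsRegularElem {M : Type*} [Monoid M] (x : M) : Prop :=
  ∃ s : M, x * s * x = x

/-- A monoid lies in the pseudovariety `DS` if each of its regular 𝒟-classes is
closed under multiplication. -/
def MonoidInDS (M : Type*) [Monoid M] : Prop :=
  ∀ a b c : M, IsRegularElem a → GreenD a b → GreenD a c → GreenD a (b * c)

theorem exists_idem_pow {M : Type*} [Monoid M] [Finite M] (s : M) :
    ∃ n : ℕ, s ^ (n + 1) * s ^ (n + 1) = s ^ (n + 1) := by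
  obtain ⟨i, j, hij, h⟩ := Finite.exists_ne_map_eq_of_infinite (fun n : ℕ => s ^ n)
  have key : ∀ i k : ℕ, s ^ (i + (k + 1)) = s ^ i →
      ∃ n : ℕ, s ^ (n + 1) * s ^ (n + 1) = s ^ (n + 1) := by
    intro i k h
    have h1 : ∀ d, s ^ (i + d + (k + 1)) = s ^ (i + d) := by
      intro d
      rw [show i + d + (k + 1) = (i + (k + 1)) + d by ring, pow_add, h, ← pow_add]
    have h2 : ∀ t d, s ^ (i + d + t * (k + 1)) = s ^ (i + d) := by
      intro t
      induction t with
      | zero => intro d; simp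
      | succ t ih =>
        intro d
        rw [show i + d + (t + 1) * (k + 1) = i + (d + t * (k + 1)) + (k + 1) by ring, h1,
          ← add_assoc, ih]
    refine ⟨(i + 1) * k + i, ?_⟩
    have h3 := h2 (i + 1) ((i + 1) * k + 1)
    rw [← pow_add]
    have e1 : (i + 1) * k + i + 1 + ((i + 1) * k + i + 1) =
      i + ((i + 1) * k + 1) + (i + 1) * (k + 1) := by ring
    have e2 : (i + 1) * k + i + 1 = i + ((i + 1) * k + 1) := by ring
    rw [e1, h3, e2]
  rcases lt_or_gt_of_ne hij with hl | hl
  · obtain ⟨k, rfl⟩ := Nat.exists_eq_add_of_lt hl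
    exact key i k h.symm
  · obtain ⟨k, rfl⟩ := Nat.exists_eq_add_of_lt hl
    exact key j k h

theorem greenR_iff {M : Type*} [Monoid M] (x y : M) :
    GreenR x y ↔ ∃ s t : M, x = y * s ∧ y = x * t := by
  constructor
  · rintro (rfl | h)
    · exact ⟨1, 1, by simp, by simp⟩
    · exact h
  · exact Or.inr

theorem greenL_iff {M : Type*} [Monoid M] (x y : M) :
    GreenL x y ↔ ∃ s t : M, x = s * y ∧ y = t * x := by
  constructor
  · rintro (rfl | h)
    · exact ⟨1, 1, by simp, by simp⟩
    · exact h
  · exact Or.inr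

/-- In `DS`, the elements above an idempotent are closed under products. -/
theorem ds_factor {M : Type*} [Monoid M] (hM : MonoidInDS M) {e s t : M} (he : e * e = e)
    (hs : ∃ x y, e = x * s * y) (ht : ∃ x y, e = x * t * y) :
    ∃ x y, e = x * (s * t) * y := by
  obtain ⟨x, y, hxy⟩ := hs
  obtain ⟨u, v, huv⟩ := ht
  have hxy' : ∀ z, x * (s * (y * z)) = e * z := by intro z; rw [hxy]; simp [mul_assoc]
  have huv' : ∀ z, u * (t * (v * z)) = e * z := by intro z; rw [huv]; simp [mul_assoc]
  have he' : ∀ z, e * (e * z) = e * z := by intro z; rw [← mul_assoc, he]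
  have h := hM e (y * e * x * s) (t * v * e * u) ⟨1, by simp [he]⟩
    ⟨e * x * s, Or.inr ⟨y, x * s, ?_, ?_⟩, Or.inr ⟨x * s, y, ?_, ?_⟩⟩
    ⟨e * u, Or.inr ⟨t * v, u, ?_, rfl⟩, Or.inr ⟨u, t * v, ?_, ?_⟩⟩
  · obtain ⟨c, h1, h2⟩ := h
    obtain ⟨p, q, h1, -⟩ := (greenR_iff _ _).1 h1
    obtain ⟨p', q', h2, -⟩ := (greenL_iff _ _).1 h2
    refine ⟨p' * (y * e * x), v * e * u * p, ?_⟩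
    refine h1.trans ?_
    refine (congrArg (fun w => w * p) h2).trans ?_
    simp only [mul_assoc]
  · have : e * x * s * y = e * (x * s * y) := by simp [mul_assoc]
    rw [this, ← hxy, he]
  · simp [mul_assoc]
  · simp [mul_assoc, hxy', he']
  · simp [mul_assoc]
  · have : e * u * (t * v) = e * (u * t * v) := by simp [mul_assoc]
    rw [this, ← huv, he]
  · simp [mul_assoc, huv', he']
  · simp [mul_assoc]

theorem not_ds {M : Type*} [Monoid M] [Finite M] (hM : ¬ MonoidInDS M) :
    ∃ x y : M, x * y * x = x ∧ ¬ ∃ s t, x = s * (x * x) * t := by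
  unfold MonoidInDS at hM
  push Not at hM
  obtain ⟨a, b, c, ⟨r, hr⟩, ⟨p, hap, hpb⟩, ⟨q, haq, hqc⟩, hn⟩ := hM
  rw [greenR_iff] at hap haq
  rw [greenL_iff] at hpb hqc
  obtain ⟨a1, a2, h1, h2⟩ := hap
  obtain ⟨b1, b2, h3, h4⟩ := hpb
  obtain ⟨c1, c2, h5, h6⟩ := haq
  obtain ⟨d1, d2, h7, h8⟩ := hqc
  -- `a = p a1`, `p = a a2`, `p = b1 b`, `b = b2 p`, `a = q c1`, `q = a c2`, `q = d1 c`, `c = d2 q`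
  have hp : p = p * (a1 * r) * p := by
    calc p = a * r * a * a2 := by rw [hr, ← h2]
      _ = p * a1 * r * (a * a2) := by rw [← h1]; simp only [mul_assoc]
      _ = _ := by rw [← h2]; simp only [mul_assoc]
  -- `x = d2 p`
  have hx1 : p = d1 * (d2 * p) := by
    calc p = q * c1 * a2 := by rw [← h5, ← h2]
      _ = d1 * (d2 * q) * c1 * a2 := by rw [← h8, ← h7]
      _ = d1 * (d2 * ((q * c1) * a2)) := by simp only [mul_assoc]
      _ = _ := by rw [← h5, ← h2]
  have hx2 : d2 * p = c * (c1 * a2) := by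
    rw [h8, h2, h5]; simp only [mul_assoc]
  have hx3 : c = d2 * p * (a1 * c2) := by
    calc c = d2 * (p * a1 * c2) := by rw [← h1, ← h6, ← h8]
      _ = _ := by simp only [mul_assoc]
  have hx4 : b = b2 * d1 * (d2 * p) := by rw [mul_assoc, ← hx1]; exact h4
  have hx5 : d2 * p = d2 * b1 * b := by rw [mul_assoc, ← h3]
  refine ⟨d2 * p, a1 * r * d1, ?_, ?_⟩
  · calc d2 * p * (a1 * r * d1) * (d2 * p) = d2 * (p * (a1 * r) * (d1 * (d2 * p))) := by
          simp only [mul_assoc]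
      _ = _ := by rw [← hx1, ← hp]
  · generalize d2 * p = x at *
    rintro ⟨s, t, hst⟩
    apply hn
    -- `x R x x`
    have hR : ∃ w, x = x * x * w := by
      obtain ⟨n, hn⟩ := exists_idem_pow s
      have hit : ∀ k, x = s ^ k * x * (x * t) ^ k := by
        intro k
        induction k with
        | zero => simp
        | succ k ih =>
          calc x = s ^ k * (s * (x * x) * t) * (x * t) ^ k := by rw [← hst]; exact ih
            _ = _ := by rw [pow_succ s, pow_succ' (x * t)]; simp only [mul_assoc]
      have hs : s ^ (n + 1) * x = x := by
        calc s ^ (n + 1) * x = s ^ (n + 1) * (s ^ (n + 1) * x * (x * t) ^ (n + 1)) := by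
              rw [← hit]
          _ = s ^ (n + 1) * s ^ (n + 1) * x * (x * t) ^ (n + 1) := by simp only [mul_assoc]
          _ = x := by rw [hn, ← hit]
      refine ⟨t * (x * t) ^ n, ?_⟩
      calc x = x * (x * t) ^ (n + 1) := by
            conv_lhs => rw [hit (n + 1), hs]
        _ = _ := by rw [pow_succ']; simp only [mul_assoc]
    obtain ⟨w, hw⟩ := hR
    have hbc : ∃ v, b = b * c * v := by
      refine ⟨c1 * a2 * w, ?_⟩
      calc b = b2 * d1 * (x * x * w) := by rw [← hw]; exact hx4
        _ = b2 * d1 * x * (c * (c1 * a2)) * w := by rw [← hx2]; simp only [mul_assoc]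
        _ = _ := by rw [← hx4]; simp only [mul_assoc]
    obtain ⟨v, hv⟩ := hbc
    refine ⟨p * c, (greenR_iff _ _).2 ⟨v * a1, a2 * c, ?_, ?_⟩,
      (greenL_iff _ _).2 ⟨b1, b2, ?_, ?_⟩⟩
    · calc a = b1 * (b * c * v) * a1 := by rw [← hv, ← h3, ← h1]
        _ = b1 * b * (c * (v * a1)) := by simp only [mul_assoc]
        _ = _ := by rw [← h3]; simp only [mul_assoc]
    · rw [← mul_assoc, ← h2]
    · rw [← mul_assoc, ← h3]
    · rw [← mul_assoc, ← h4]

/-- The Rees congruence of the ideal of elements not above `x`. -/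
def reesCon {M : Type*} [Monoid M] (x : M) : Con M where
  r m n := m = n ∨ ((¬ ∃ s t, x = s * m * t) ∧ ¬ ∃ s t, x = s * n * t)
  iseqv := ⟨fun _ => Or.inl rfl, by
      rintro m n (rfl | ⟨h1, h2⟩)
      · exact Or.inl rfl
      · exact Or.inr ⟨h2, h1⟩, by
      rintro m n k (rfl | ⟨h1, h2⟩) (rfl | ⟨h3, h4⟩)
      · exact Or.inl rfl
      · exact Or.inr ⟨h3, h4⟩
      · exact Or.inr ⟨h1, h2⟩
      · exact Or.inr ⟨h1, h4⟩⟩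
  mul' := by
    have hl : ∀ m n : M, (¬ ∃ s t, x = s * m * t) → ¬ ∃ s t, x = s * (m * n) * t := by
      rintro m n h ⟨s, t, e⟩
      exact h ⟨s, n * t, by rw [e]; simp only [mul_assoc]⟩
    have hr : ∀ m n : M, (¬ ∃ s t, x = s * n * t) → ¬ ∃ s t, x = s * (m * n) * t := by
      rintro m n h ⟨s, t, e⟩
      exact h ⟨s * m, t, by rw [e]; simp only [mul_assoc]⟩
    rintro w x y z (rfl | ⟨h1, h2⟩) (rfl | ⟨h3, h4⟩)
    · exact Or.inl rfl
    · exact Or.inr ⟨hr _ _ h3, hr _ _ h4⟩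
    · exact Or.inr ⟨hl _ _ h1, hl _ _ h2⟩
    · exact Or.inr ⟨hl _ _ h1, hl _ _ h2⟩

theorem rees_props {M : Type*} [Monoid M] (x y : M) (h : x * y * x = x)
    (hx : ¬ ∃ s t, x = s * (x * x) * t) :
    ∃ X Y Z : (reesCon x).Quotient, X * Y * X = X ∧ X * X = Z ∧ X ≠ Z ∧
      (∀ k, k * Z = Z) ∧ ∀ k, Z * k = Z := by
  refine ⟨(x : (reesCon x).Quotient), (y : (reesCon x).Quotient),
    ((x * x : M) : (reesCon x).Quotient), ?_, rfl, ?_, ?_, ?_⟩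
  · rw [← Con.coe_mul, ← Con.coe_mul, h]
  · intro e
    rcases (Con.eq _).1 e with e | e
    · exact hx ⟨1, 1, by simpa using e⟩
    · exact e.1 ⟨1, 1, by simp⟩
  · intro k
    induction k using Con.induction_on with
    | H k =>
      rw [← Con.coe_mul]
      refine (Con.eq _).2 (Or.inr ⟨?_, hx⟩)
      rintro ⟨s, t, e⟩
      exact hx ⟨s * k, t, by rw [mul_assoc s k]; exact e⟩
  · intro k
    induction k using Con.induction_on with
    | H k =>
      rw [← Con.coe_mul]
      refine (Con.eq _).2 (Or.inr ⟨?_, hx⟩)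
      rintro ⟨s, t, e⟩
      exact hx ⟨s, k * t, e.trans (by simp only [mul_assoc])⟩

theorem interleave_cons {α : Type*} (a b : α) (as bs : List α) :
    interleave (a :: as) (b :: bs) = a :: b :: interleave as bs := by
  simp [interleave]

theorem interleave_append {α : Type*} (as as' bs bs' : List α) (h : as.length = bs.length) :
    interleave (as ++ as') (bs ++ bs') = interleave as bs ++ interleave as' bs' := by
  simp [interleave, List.zip_append h]

theorem mem_interleave {α : Type*} (as bs : List α) (h : bs.length = as.length) (c : α)
    (hc : c ∈ as) : c ∈ interleave as bs := by
  induction as generalizing bs with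
  | nil => simp at hc
  | cons a as ih =>
    cases bs with
    | nil => simp at h
    | cons b bs =>
      rw [interleave_cons]
      rcases List.mem_cons.1 hc with rfl | hc
      · simp
      · have := ih bs (by simpa using h) hc
        simp [this]

theorem run_append (step : Q → σ → Q) (q : Q) (u v : List σ) :
    run step q (u ++ v) = run step (run step q u) v := by
  simp [run, List.foldl_append]

/-- The element of the transition monoid given by a word. -/
def tmk (step : Q → σ → Q) (w : List σ) : transMonoid step := ⟨op (tau step w), w, rfl⟩

theorem tmk_append (step : Q → σ → Q) (u v : List σ) :
    tmk step (u ++ v) = tmk step u * tmk step v := by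
  apply Subtype.ext
  show op (tau step (u ++ v)) = op (tau step u) * op (tau step v)
  rw [← op_mul]
  congr 1
  funext q
  exact run_append step q u v

theorem isReset_of_factor (step : Q → σ → Q) (w z : List σ) (hz : IsReset step z)
    (h : ∃ x y, tmk step w = x * tmk step z * y) : IsReset step w := by
  obtain ⟨⟨_, u, rfl⟩, ⟨_, v, rfl⟩, h⟩ := h
  change tmk step w = tmk step u * tmk step z * tmk step v at h
  rw [← tmk_append, ← tmk_append] at h
  have h2 : tau step w = tau step (u ++ z ++ v) := op_injective (congrArg Subtype.val h)
  have h3 : ∀ q, run step q w = run step q (u ++ z ++ v) := fun q => congrFun h2 q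
  intro p q
  rw [h3, h3, run_append, run_append, run_append, run_append]
  rw [hz (run step p u) (run step q u)]

theorem interleave_blocks {α : Type*} (z : List α) (k : ℕ) (bs : List α)
    (h : bs.length = (List.replicate k z).flatten.length) :
    ∃ ws : List (List α), ws.length = k ∧
      ws.flatten = interleave (List.replicate k z).flatten bs ∧
      ∀ w ∈ ws, ∀ c ∈ z, c ∈ w := by
  induction k generalizing bs with
  | zero => exact ⟨[], rfl, by simp [interleave], by simp⟩
  | succ k ih =>
    rw [List.replicate_succ, List.flatten_cons, List.length_append] at h
    obtain ⟨ws, h1, h2, h3⟩ := ih (bs.drop z.length) (by rw [List.length_drop]; omega)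
    have hl : (bs.take z.length).length = z.length := by rw [List.length_take]; omega
    refine ⟨interleave z (bs.take z.length) :: ws, by simp [h1], ?_, ?_⟩
    · rw [List.flatten_cons, h2, List.replicate_succ, List.flatten_cons,
        ← interleave_append _ _ _ _ hl.symm, List.take_append_drop]
    · intro w hw
      rcases List.mem_cons.1 hw with rfl | hw
      · exact fun c hc => mem_interleave _ _ hl c hc
      · exact h3 w hw

theorem reset_of_blocks (step : Q → σ → Q) [Finite (transMonoid step)]
    (hM : MonoidInDS (transMonoid step)) (z : List σ) (hz : IsReset step z)
    (ws : List (List σ)) (hlen : ws.length = Nat.card (transMonoid step))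
    (hc : ∀ w ∈ ws, ∀ c ∈ z, c ∈ w) : IsReset step ws.flatten := by
  have hpig : ∃ i j : ℕ, i < j ∧ j ≤ ws.length ∧
      tmk step (ws.take i).flatten = tmk step (ws.take j).flatten := by
    have hnot : ¬ Function.Injective
        (fun i : Fin (ws.length + 1) => tmk step (ws.take i).flatten) := by
      intro hi
      have := Nat.card_le_card_of_injective _ hi
      rw [Nat.card_fin] at this
      omega
    unfold Function.Injective at hnot
    push Not at hnot
    obtain ⟨i, j, he, hne⟩ := hnot
    rcases lt_or_gt_of_ne hne with hl | hl
    · exact ⟨i, j, hl, by omega, he⟩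
    · exact ⟨j, i, hl, by omega, he.symm⟩
  obtain ⟨i, j, hij, hj, he⟩ := hpig
  obtain ⟨k, rfl⟩ := Nat.exists_eq_add_of_lt hij
  have hsplit : ws.take (i + k + 1) = ws.take i ++ ws[i] :: (ws.drop (i + 1)).take k := by
    rw [add_assoc, List.take_add, List.drop_eq_getElem_cons (by omega), List.take_succ_cons]
  set s := ws[i] ++ ((ws.drop (i + 1)).take k).flatten with hs
  have he2 : tmk step (ws.take i).flatten = tmk step (ws.take i).flatten * tmk step s := by
    conv_lhs => rw [he, hsplit, List.flatten_append, List.flatten_cons, tmk_append]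
  have hmem : ∀ c ∈ z, c ∈ s := fun c hcz =>
    List.mem_append_left _ (hc _ (List.getElem_mem _) c hcz)
  clear_value s
  have hpow : ∀ n, tmk step (ws.take i).flatten = tmk step (ws.take i).flatten * tmk step s ^ n := by
    intro n
    induction n with
    | zero => simp
    | succ n ih => rw [pow_succ, ← mul_assoc, ← ih, ← he2]
  obtain ⟨n, hn⟩ := exists_idem_pow (tmk step s)
  have hlet : ∀ c ∈ z, ∃ x y, tmk step s ^ (n + 1) = x * tmk step [c] * y := by
    intro c hcz
    have hcs : c ∈ s := hmem c hcz
    obtain ⟨u, v, huv⟩ := List.append_of_mem hcs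
    refine ⟨tmk step u, tmk step v * tmk step s ^ n, ?_⟩
    rw [pow_succ']
    have h4 : tmk step s = tmk step u * (tmk step [c] * tmk step v) := by
      rw [huv, ← List.singleton_append, tmk_append, tmk_append]
    calc tmk step s * tmk step s ^ n
        = tmk step u * (tmk step [c] * tmk step v) * tmk step s ^ n := by rw [← h4]
      _ = _ := by simp only [mul_assoc]
  have hall : ∀ l : List σ, (∀ c ∈ l, c ∈ z) →
      ∃ x y, tmk step s ^ (n + 1) = x * tmk step l * y := by
    intro l
    induction l with
    | nil =>
      intro _
      exact ⟨tmk step s ^ (n + 1), 1, by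
        rw [mul_one, show tmk step [] = 1 from rfl, mul_one]⟩
    | cons c l ih =>
      intro h
      rw [← List.singleton_append, tmk_append]
      exact ds_factor hM hn (hlet c (h c (by simp))) (ih fun d hd => h d (by simp [hd]))
  obtain ⟨x, y, hxy⟩ := hall z fun _ h => h
  apply isReset_of_factor step _ z hz
  refine ⟨tmk step (ws.take i).flatten * x, y * tmk step (ws.drop i).flatten, ?_⟩
  have : ws.flatten = (ws.take i).flatten ++ (ws.drop i).flatten := by
    rw [← List.flatten_append, List.take_append_drop]
  have h5 := hpow (n + 1)
  rw [hxy] at h5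
  rw [this, tmk_append]
  calc _ = tmk step (ws.take i).flatten * (x * tmk step z * y) * tmk step (ws.drop i).flatten := by
        rw [← h5]
    _ = _ := by simp only [mul_assoc]

/-- Right multiplication automaton on a monoid. -/
def mulStep {K : Type*} [Monoid K] (X Y : K) : K → Option Bool → K
  | q, none => q
  | q, some true => q * X
  | q, some false => q * Y

theorem run_mulStep {K : Type*} [Monoid K] (X Y : K) (w : List (Option Bool)) (q : K) :
    run (mulStep X Y) q w = q * run (mulStep X Y) 1 w := by
  induction w using List.reverseRecOn with
  | nil => simp [run]
  | append_singleton w a ih =>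
    rw [run_append, run_append, ih]
    rcases a with _ | _ | _ <;> simp [run, mulStep, mul_assoc]

/-- The transition monoid of the right multiplication automaton embeds in the monoid. -/
def mulStepHom {K : Type*} [Monoid K] (X Y : K) : transMonoid (mulStep X Y) →* K where
  toFun t := t.1.unop (1 : K)
  map_one' := rfl
  map_mul' := by
    rintro ⟨_, u, rfl⟩ ⟨_, v, rfl⟩
    exact run_mulStep X Y v (run (mulStep X Y) 1 u)

theorem mulStepHom_injective {K : Type*} [Monoid K] (X Y : K) :
    Function.Injective (mulStepHom X Y) := by
  rintro ⟨_, u, rfl⟩ ⟨_, v, rfl⟩ h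
  have h' : run (mulStep X Y) 1 u = run (mulStep X Y) 1 v := h
  apply Subtype.ext
  show op (tau _ u) = op (tau _ v)
  congr 1
  funext q
  show run _ q u = run _ q v
  rw [run_mulStep, h', ← run_mulStep]

theorem survive {K : Type*} [Monoid K] (X Y Z : K) (h1 : X * Y * X = X) (h2 : X ≠ Z)
    (as : List (Option Bool)) :
    ∃ bs : List (Option Bool), bs.length = as.length ∧
      ∃ q, (q = X ∨ q = X * Y) ∧ run (mulStep X Y) q (interleave as bs) ≠ Z := by
  induction as with
  | nil => exact ⟨[], rfl, X, Or.inl rfl, by simpa [run, interleave] using h2⟩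
  | cons a as ih =>
    obtain ⟨bs, hb, q, hq, hne⟩ := ih
    have key : ∃ b q', (q' = X ∨ q' = X * Y) ∧
        mulStep X Y (mulStep X Y q' a) b = q := by
      rcases a with _ | _ | _
      · exact ⟨none, q, hq, rfl⟩
      · rcases hq with rfl | rfl
        · exact ⟨some true, q, Or.inl rfl, h1⟩
        · exact ⟨none, X, Or.inl rfl, rfl⟩
      · rcases hq with rfl | rfl
        · exact ⟨none, q * Y, Or.inr rfl, h1⟩
        · exact ⟨some false, X * Y, Or.inr rfl, by simp [mulStep, h1]⟩
    obtain ⟨b, q', hq', hb'⟩ := key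
    refine ⟨b :: bs, by simp [hb], q', hq', ?_⟩
    rw [interleave_cons]
    show run (mulStep X Y) (mulStep X Y (mulStep X Y q' a) b) _ ≠ Z
    rw [hb']
    exact hne

/-- For a monoid pseudovariety `P` (an isomorphism-invariant
property of finite monoids closed under submonoids, surjective homomorphic
images and binary direct products), every synchronizing DFA whose transition
monoid satisfies `P` admits a uniform winning strategy iff every finite monoid
satisfying `P` lies in `DS`. -/
theorem uniform_strategy_iff_pseudovariety_in_DS
    (P : (M : Type) → [Monoid M] → Prop)
    (hiso : ∀ (M N : Type) [Monoid M] [Monoid N] [Finite M] [Finite N],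
      (M ≃* N) → P M → P N)
    (hsub : ∀ (M N : Type) [Monoid M] [Monoid N] [Finite M] [Finite N]
      (f : M →* N), Function.Injective f → P N → P M)
    (himg : ∀ (M N : Type) [Monoid M] [Monoid N] [Finite M] [Finite N]
      (f : M →* N), Function.Surjective f → P M → P N)
    (hprod : ∀ (M N : Type) [Monoid M] [Monoid N] [Finite M] [Finite N],
      P M → P N → P (M × N)) :
    (∀ (Q σ : Type) [Finite Q] [Nonempty Q] [Finite σ] (step : Q → σ → Q),
        P ↥(transMonoid step) → (∃ w : List σ, IsReset step w) →
        ∃ as : List σ, ∀ bs : List σ, bs.length = as.length →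
          IsReset step (interleave as bs)) ↔
      (∀ (M : Type) [Monoid M] [Finite M], P M → MonoidInDS M) := by
  have finT : ∀ (Q σ : Type) [Finite Q] (step : Q → σ → Q), Finite (transMonoid step) := by
    intro Q σ _ step
    haveI : Finite (Function.End Q) := inferInstanceAs (Finite (Q → Q))
    haveI : Finite (Function.End Q)ᵐᵒᵖ := Finite.of_equiv _ opEquiv
    exact inferInstance
  constructor
  · intro H M _ _ hPM
    by_contra hds
    obtain ⟨x, y, hxy, hxx⟩ := not_ds hds
    obtain ⟨X, Y, Z, h1, h2, h3, h4, h5⟩ := rees_props x y hxy hxx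
    haveI : Finite (reesCon x).Quotient := Finite.of_surjective _ (reesCon x).mk'_surjective
    have hPK : P (reesCon x).Quotient := himg _ _ (reesCon x).mk' (reesCon x).mk'_surjective hPM
    haveI := finT _ _ (mulStep X Y)
    have hPT : P (transMonoid (mulStep X Y)) :=
      hsub _ _ (mulStepHom X Y) (mulStepHom_injective X Y) hPK
    obtain ⟨as, has⟩ := H _ _ (mulStep X Y) hPT ⟨[some true, some true], by
      have : ∀ q, run (mulStep X Y) q [some true, some true] = Z := by
        intro q
        show q * X * X = Z
        rw [mul_assoc, h2, h4]
      intro p q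
      rw [this, this]⟩
    obtain ⟨bs, hb, q, -, hne⟩ := survive X Y Z h1 h3 as
    apply hne
    rw [has bs hb q Z, run_mulStep, h5]
  · intro H Q σ _ _ _ step hP hz
    obtain ⟨z, hz⟩ := hz
    haveI := finT Q σ step
    refine ⟨(List.replicate (Nat.card (transMonoid step)) z).flatten, fun bs hbs => ?_⟩
    obtain ⟨ws, hw1, hw2, hw3⟩ := interleave_blocks z _ bs hbs
    rw [← hw2]
    exact reset_of_blocks step (H _ hP) z hz ws hw1 hw3
end

section
/- Every synchronizing weakly acyclic DFA admits a uniform winning strategy: if a DFA is weakly acyclic and synchronizing, then there exists a word a₁⋯aₙ over Σ such that for every choice of letters b₁,…,bₙ ∈ Σ the interleaved word a₁b₁⋯aₙbₙ is a reset word. -/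
open MulOpposite

variable {Q σ : Type*}

theorem aux_run_append {Q σ : Type*} (step : Q → σ → Q) (q : Q) (u v : List σ) :
    run step q (u ++ v) = run step (run step q u) v := by
  simp [run]

theorem aux_inter_cons {σ : Type*} (a b : σ) (u v : List σ) :
    interleave (a :: u) (b :: v) = a :: b :: interleave u v := by
  simp [interleave]

theorem aux_inter_append {σ : Type*} (u u' v v' : List σ) (h : u.length = u'.length) :
    interleave (u ++ v) (u' ++ v') = interleave u u' ++ interleave v v' := by
  simp [interleave, List.zip_append h]

theorem aux_block {Q σ : Type*} (step : Q → σ → Q)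
    (hacyclic : ∀ p q : Q, (∃ u : List σ, run step p u = q) →
      (∃ v : List σ, run step q v = p) → p = q) (q : Q) (L : List σ) :
    ∀ bs : List σ, bs.length = L.length → run step q (interleave L bs) = q →
      ∀ a ∈ L, step q a = q := by
  induction L with
  | nil => simp
  | cons a L ih =>
    intro bs hl hr
    cases bs with
    | nil => simp at hl
    | cons b bs =>
      rw [aux_inter_cons] at hr
      have h1 : q = step q a := hacyclic _ _ ⟨[a], rfl⟩ ⟨b :: interleave L bs, hr⟩
      have h2 : q = step (step q a) b := hacyclic _ _ ⟨[a, b], rfl⟩ ⟨interleave L bs, hr⟩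
      have h3 : run step (step (step q a) b) (interleave L bs) = q := hr
      rw [← h2] at h3
      intro c hc
      rcases List.mem_cons.1 hc with rfl | hc
      · exact h1.symm
      · exact ih bs (by simpa using hl) h3 c hc

theorem aux_fix {Q σ : Type*} (step : Q → σ → Q) (q : Q) (h : ∀ a, step q a = q)
    (w : List σ) : run step q w = q := by
  induction w with
  | nil => rfl
  | cons a w ih =>
    change run step (step q a) w = q
    rw [h, ih]

theorem aux_main {Q σ : Type*} [Finite Q] (step : Q → σ → Q)
    (hacyclic : ∀ p q : Q, (∃ u : List σ, run step p u = q) →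
      (∃ v : List σ, run step q v = p) → p = q) (z : Q)
    (hz : ∀ a, step z a = z) (hw : ∀ q, ∃ w, run step q w = z)
    (L : List σ) (hL : ∀ a, a ∈ L) (n : ℕ) :
    ∀ q, {p | ∃ u, run step q u = p}.ncard ≤ n → ∀ bs : List σ,
      bs.length = (List.replicate n L).flatten.length →
      run step q (interleave (List.replicate n L).flatten bs) = z := by
  induction n with
  | zero =>
    intro q hq
    have : 0 < {p | ∃ u, run step q u = p}.ncard :=
      (Set.ncard_pos (Set.toFinite _)).2 ⟨q, [], rfl⟩
    omega
  | succ n ih =>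
    intro q hq bs hbs
    by_cases hqz : q = z
    · rw [hqz]; exact aux_fix step z hz _
    rw [List.replicate_succ, List.flatten_cons] at hbs ⊢
    rw [List.length_append] at hbs
    have hlen : (bs.take L.length).length = L.length := by
      rw [List.length_take]; omega
    rw [← List.take_append_drop L.length bs, aux_inter_append _ _ _ _ hlen.symm, aux_run_append]
    apply ih
    · apply Nat.le_of_lt_succ
      refine lt_of_lt_of_le (Set.ncard_lt_ncard ?_ (Set.toFinite _)) hq
      refine (Set.ssubset_iff_of_subset ?_).2 ⟨q, ⟨[], rfl⟩, ?_⟩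
      · rintro p ⟨u, hu⟩
        exact ⟨_, (aux_run_append step q _ u).trans hu⟩
      · intro hback
        have h1 := hacyclic _ _ ⟨_, rfl⟩ hback
        have h2 := aux_block step hacyclic q L _ hlen h1.symm
        obtain ⟨w, hw⟩ := hw q
        rw [aux_fix step q (fun a => h2 a (hL a))] at hw
        exact hqz hw
    · rw [List.length_drop]; omega

/-- Every synchronizing weakly acyclic DFA admits a uniform
winning strategy. -/
theorem weakly_acyclic_uniform_winning_strategy
    {Q σ : Type*} [Finite Q] [Nonempty Q] [Finite σ]
    (step : Q → σ → Q)
    (hacyclic : ∀ p q : Q, (∃ u : List σ, run step p u = q) →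
      (∃ v : List σ, run step q v = p) → p = q)
    (hsync : ∃ w : List σ, IsReset step w) :
    ∃ as : List σ, ∀ bs : List σ, bs.length = as.length →
      IsReset step (interleave as bs) := by
  obtain ⟨w, hw⟩ := hsync
  obtain ⟨q₀⟩ := ‹Nonempty Q›
  have hz : ∀ q, run step q w = run step q₀ w := fun q => hw q q₀
  generalize run step q₀ w = z at hz
  have hfix : ∀ a, step z a = z := fun a =>
    (hacyclic z (step z a) ⟨[a], rfl⟩ ⟨w, hz _⟩).symm
  have := Fintype.ofFinite σ
  refine ⟨(List.replicate (Nat.card Q) (Finset.univ : Finset σ).toList).flatten, ?_⟩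
  intro bs hbs p q
  have key := fun q => aux_main step hacyclic z hfix (fun q => ⟨w, hz q⟩)
    (Finset.univ : Finset σ).toList (by simp) (Nat.card Q) q (Set.ncard_le_card _) bs hbs
  rw [key p, key q]
end
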